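/- arXiv:1707.02728 — 2 statements merged into one kernel-verified Lean document; each statement's English description precedes it below -/
import Mathlib

section
/- Let n be a positive integer and let c_n(m) denote the Ramanujan sum. Then there exists m ∈ {0, 1, …, n−1} with c_n(m) ∈ {1, −1} if and only if n is squarefree; moreover, when n is squarefree, the number of indices m ∈ {0, 1, …, n−1} with c_n(m) ∈ {1, −1} equals φ(n) if n is odd and equals 2φ(n/2) if n is even. -/
/-- The Ramanujan sum `c_n(m) = ∑_{1 ≤ k ≤ n, gcd(k,n)=1} e^{2πikm/n}`. -/
noncomputable def ramanujanSum (n m : ℕ) : ℂ :=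
  ∑ k ∈ (Finset.Icc 1 n).filter (fun k => Nat.Coprime k n),
    Complex.exp (2 * Real.pi * Complex.I * k * m / n)

open ArithmeticFunction in
/-- The sum of the primitive `n`-th roots of unity is the Möbius function. -/
theorem sum_primitiveRoots_eq_moebius {n : ℕ} (hn : 0 < n) :
    ∑ z ∈ primitiveRoots n ℂ, z = (moebius n : ℂ) := by
  classical
  have key := (sum_eq_iff_sum_mul_moebius_eq (R := ℂ)
    (f := fun k => ∑ z ∈ primitiveRoots k ℂ, z) (g := fun k => if k = 1 then 1 else 0)).1 ?_ n hn
  · rw [← key, Finset.sum_eq_single (n, 1)]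
    · simp
    · rintro ⟨a, b⟩ hab hne
      have hb : b ≠ 1 := by
        rintro rfl
        simp only [Nat.mem_divisorsAntidiagonal, mul_one] at hab
        exact hne (by rw [hab.1])
      simp [hb]
    · simp [hn.ne']
  · intro k hk
    have hζ := Complex.isPrimitiveRoot_exp k hk.ne'
    rw [← Finset.sum_biUnion fun i _ j _ hij => IsPrimitiveRoot.disjoint hij,
      ← IsPrimitiveRoot.nthRoots_one_eq_biUnion_primitiveRoots]
    have himg : Polynomial.nthRootsFinset k (1 : ℂ) =
        (Finset.range k).image (Complex.exp (2 * Real.pi * Complex.I / k) ^ ·) := by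
      ext z
      simp only [Polynomial.mem_nthRootsFinset hk, Finset.mem_image, Finset.mem_range]
      constructor
      · intro hz
        have : NeZero k := ⟨hk.ne'⟩
        exact hζ.eq_pow_of_pow_eq_one hz
      · rintro ⟨i, -, rfl⟩
        rw [pow_right_comm, hζ.pow_eq_one, one_pow]
    rw [himg, Finset.sum_image]
    · split_ifs with h1
      · subst h1; simp
      · exact hζ.geom_sum_eq_zero (by omega)
    · intro i hi j hj hij
      exact hζ.pow_inj (by simpa using hi) (by simpa using hj) hij

/-- Summing over the fibres of a surjective homomorphism of finite groups. -/
theorem card_mul_sum_comp_of_surjective {G H R : Type*} [Group G] [Group H] [Fintype G]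
    [Fintype H] [CommSemiring R] (f : G →* H) (hf : Function.Surjective f) (F : H → R) :
    (Fintype.card H : R) * ∑ g, F (f g) = Fintype.card G * ∑ h, F h := by
  have h1 : ∀ h : H, ∑ g, F (f g * h) = ∑ g, F (f g) := fun h => by
    obtain ⟨w, rfl⟩ := hf h
    simpa using Equiv.sum_comp (Equiv.mulRight w) fun g => F (f g)
  have h2 : ∀ g : G, ∑ h, F (f g * h) = ∑ h, F h := fun g =>
    Equiv.sum_comp (Equiv.mulLeft (f g)) F
  have h3 : ∑ h, ∑ g, F (f g * h) = ∑ g, ∑ h, F (f g * h) := Finset.sum_comm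
  simpa [h1, h2] using h3

theorem sum_units_zmod_eq_sum_coprime {R : Type*} [AddCommMonoid R] (n : ℕ) [NeZero n]
    (f : ℕ → R) :
    ∑ u : (ZMod n)ˣ, f (u : ZMod n).val =
      ∑ k ∈ (Finset.range n).filter (fun k => Nat.Coprime k n), f k := by
  refine Finset.sum_bij (fun u _ => (u : ZMod n).val) ?_ ?_ ?_ ?_
  · intro u _
    simpa [ZMod.val_lt] using ZMod.val_coe_unit_coprime u
  · intro u _ v _ h
    exact Units.ext (ZMod.val_injective n h)
  · intro k hk
    simp only [Finset.mem_filter, Finset.mem_range] at hk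
    exact ⟨ZMod.unitOfCoprime k hk.2, Finset.mem_univ _, by
      rw [ZMod.coe_unitOfCoprime, ZMod.val_natCast, Nat.mod_eq_of_lt hk.1]⟩
  · intros; rfl

theorem sum_units_pow_eq_moebius {d : ℕ} [NeZero d] {ζ : ℂ} (hζ : IsPrimitiveRoot ζ d) :
    ∑ u : (ZMod d)ˣ, ζ ^ (u : ZMod d).val = (ArithmeticFunction.moebius d : ℂ) := by
  have hd : 0 < d := NeZero.pos d
  rw [sum_units_zmod_eq_sum_coprime d (ζ ^ ·), ← sum_primitiveRoots_eq_moebius hd]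
  refine Finset.sum_bij (fun i _ => ζ ^ i) ?_ ?_ ?_ ?_
  · intro i hi
    exact (mem_primitiveRoots hd).2 (hζ.pow_of_coprime i (Finset.mem_filter.1 hi).2)
  · intro i hi j hj h
    exact hζ.pow_inj (by simpa using (Finset.mem_filter.1 hi).1)
      (by simpa using (Finset.mem_filter.1 hj).1) h
  · intro z hz
    obtain ⟨i, hi, hc, h⟩ := hζ.isPrimitiveRoot_iff.1 ((mem_primitiveRoots hd).1 hz)
    exact ⟨i, Finset.mem_filter.2 ⟨Finset.mem_range.2 hi, hc⟩, h⟩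
  · intros; rfl

theorem sum_Icc_coprime_eq_sum_range {R : Type*} [AddCancelCommMonoid R] (n : ℕ) (f : ℕ → R)
    (hf : f n = f 0) :
    ∑ k ∈ (Finset.Icc 1 n).filter (fun k => Nat.Coprime k n), f k =
      ∑ k ∈ (Finset.range n).filter (fun k => Nat.Coprime k n), f k := by
  rw [Finset.sum_filter, Finset.sum_filter]
  have h1 := Finset.sum_range_succ (fun k => if Nat.Coprime k n then f k else 0) n
  rw [Finset.sum_range_succ'] at h1
  have h2 : ∑ k ∈ Finset.Icc 1 n, (if Nat.Coprime k n then f k else 0) =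
      ∑ k ∈ Finset.range n, if Nat.Coprime (k + 1) n then f (k + 1) else 0 := by
    rw [Finset.range_eq_Ico,
      Finset.sum_Ico_add' (fun k => if Nat.Coprime k n then f k else 0) 0 n 1]
    rfl
  rw [h2]
  simpa [hf] using h1

/-- The von Sterneck formula for Ramanujan sums, in division-free form. -/
theorem totient_mul_ramanujanSum {n : ℕ} (hn : 0 < n) (m : ℕ) :
    (Nat.totient (n / n.gcd m) : ℂ) * ramanujanSum n m =
      Nat.totient n * (ArithmeticFunction.moebius (n / n.gcd m) : ℂ) := by
  have hdn : n / n.gcd m ∣ n := Nat.div_dvd_of_dvd (Nat.gcd_dvd_left n m)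
  have hg : 0 < n.gcd m := Nat.gcd_pos_of_pos_left m hn
  have hd : 0 < n / n.gcd m := Nat.div_pos (Nat.gcd_le_left m hn) hg
  set d := n / n.gcd m
  have : NeZero n := ⟨hn.ne'⟩
  have : NeZero d := ⟨hd.ne'⟩
  have hξ := Complex.isPrimitiveRoot_exp n hn.ne'
  set ζ : ℂ := Complex.exp (2 * Real.pi * Complex.I / n) ^ m with hζ_def
  have hζ : IsPrimitiveRoot ζ d := by
    rw [IsPrimitiveRoot.iff_orderOf, hζ_def, IsOfFinOrder.orderOf_pow _ _ (hξ.isOfFinOrder hn.ne'), ← hξ.eq_orderOf]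
  have hζn : ζ ^ n = 1 := (hζ.pow_eq_one_iff_dvd n).2 hdn
  have hsum : ramanujanSum n m =
      ∑ u : (ZMod n)ˣ, ζ ^ ((ZMod.unitsMap hdn u : (ZMod d)ˣ) : ZMod d).val := by
    have h1 : ramanujanSum n m =
        ∑ k ∈ (Finset.Icc 1 n).filter (fun k => Nat.Coprime k n), ζ ^ k := by
      refine Finset.sum_congr rfl fun k _ => ?_
      rw [hζ_def, ← pow_mul, ← Complex.exp_nat_mul]
      congr 1
      push_cast
      ring
    rw [h1, sum_Icc_coprime_eq_sum_range n _ (by simpa using hζn),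
      ← sum_units_zmod_eq_sum_coprime]
    refine Finset.sum_congr rfl fun u _ => ?_
    have hv : ((ZMod.unitsMap hdn u : (ZMod d)ˣ) : ZMod d).val = (u : ZMod n).val % d := by
      rw [ZMod.unitsMap_val, ← ZMod.natCast_val, ZMod.val_natCast]
    rw [hv, hζ.eq_orderOf, pow_mod_orderOf]
  rw [hsum, ← sum_units_pow_eq_moebius hζ, ← ZMod.card_units_eq_totient,
    ← ZMod.card_units_eq_totient]
  exact card_mul_sum_comp_of_surjective (ZMod.unitsMap hdn) (ZMod.unitsMap_surjective hdn)
    fun v => ζ ^ (v : ZMod d).val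

theorem ramanujanSum_pm_one_iff_totient {n : ℕ} (hn : 0 < n) (m : ℕ) :
    (ramanujanSum n m = 1 ∨ ramanujanSum n m = -1) ↔
      Squarefree (n / n.gcd m) ∧ Nat.totient (n / n.gcd m) = Nat.totient n := by
  have h := totient_mul_ramanujanSum hn m
  have hd : 0 < n / n.gcd m :=
    Nat.div_pos (Nat.gcd_le_left m hn) (Nat.gcd_pos_of_pos_left m hn)
  set d := n / n.gcd m
  have hφd : Nat.totient d ≠ 0 := (Nat.totient_pos.2 hd).ne'
  have hφn : Nat.totient n ≠ 0 := (Nat.totient_pos.2 hn).ne'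
  have hφd' : (Nat.totient d : ℂ) ≠ 0 := by exact_mod_cast hφd
  constructor
  · intro hc
    have hz : (Nat.totient d : ℤ) = Nat.totient n * ArithmeticFunction.moebius d ∨
        -(Nat.totient d : ℤ) = Nat.totient n * ArithmeticFunction.moebius d := by
      rcases hc with hc | hc <;> rw [hc] at h
      · left; rw [mul_one] at h; exact_mod_cast h
      · right; rw [mul_neg_one] at h; exact_mod_cast h
    refine ⟨ArithmeticFunction.moebius_ne_zero_iff_squarefree.1 fun h0 => ?_, ?_⟩
    · rw [h0] at hz; omega
    · rcases ArithmeticFunction.moebius_eq_or d with h0 | h0 | h0 <;> rw [h0] at hz <;> omega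
  · rintro ⟨hs, he⟩
    rw [← he] at h
    rw [mul_left_cancel₀ hφd' h]
    rcases ArithmeticFunction.moebius_ne_zero_iff_eq_or.1
      (ArithmeticFunction.moebius_ne_zero_iff_squarefree.2 hs) with h0 | h0 <;> simp [h0]

theorem Nat.squarefree_two_mul_of_odd {a : ℕ} (ha : Odd a) (hs : Squarefree a) :
    Squarefree (2 * a) :=
  (Nat.squarefree_mul (Nat.coprime_two_left.2 ha)).2 ⟨Nat.prime_two.prime.squarefree, hs⟩

theorem ramanujanSum_pm_one_iff_gcd {n : ℕ} (hn : 0 < n) (m : ℕ) :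
    (ramanujanSum n m = 1 ∨ ramanujanSum n m = -1) ↔
      Squarefree n ∧ (n.gcd m = 1 ∨ n.gcd m = 2) := by
  rw [ramanujanSum_pm_one_iff_totient hn]
  have hmul : n / n.gcd m * n.gcd m = n := Nat.div_mul_cancel (Nat.gcd_dvd_left n m)
  have hg : 0 < n.gcd m := Nat.gcd_pos_of_pos_left m hn
  have hd : 0 < n / n.gcd m := Nat.div_pos (Nat.gcd_le_left m hn) hg
  set d := n / n.gcd m
  set g := n.gcd m
  constructor
  · rintro ⟨hs, he⟩
    rcases Nat.eq_or_eq_of_totient_eq_totient ⟨g, hmul.symm⟩ he with h | h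
    · exact ⟨h ▸ hs, .inl (by nlinarith)⟩
    · refine ⟨?_, .inr (by nlinarith)⟩
      rcases Nat.even_or_odd d with hev | hodd
      · rw [← h, Nat.totient_two_mul_of_even hev] at he
        have := Nat.totient_pos.2 hd
        omega
      · exact h ▸ Nat.squarefree_two_mul_of_odd hodd hs
  · rintro ⟨hs, h | h⟩
    · rw [h, mul_one] at hmul
      exact ⟨hmul ▸ hs, by rw [hmul]⟩
    · rw [h, mul_comm] at hmul
      rw [← hmul] at hs
      have hcop := Nat.coprime_of_squarefree_mul hs
      refine ⟨hs.of_mul_right, ?_⟩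
      rw [← hmul, Nat.totient_two_mul_of_odd (Nat.coprime_two_left.1 hcop)]

open Classical in
/-- Some value `c_n(m)` with `0 ≤ m < n` equals `±1` iff `n` is squarefree; and in that case
the number of such indices `m` is `φ(n)` for odd `n` and `2φ(n/2)` for even `n`. -/
theorem ramanujanSum_pm_one_iff_squarefree (n : ℕ) (hn : 0 < n) :
    ((∃ m ∈ Finset.range n, ramanujanSum n m = 1 ∨ ramanujanSum n m = -1) ↔ Squarefree n) ∧
    (Squarefree n →
      ((Finset.range n).filter
          (fun m => ramanujanSum n m = 1 ∨ ramanujanSum n m = -1)).card =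
        if Odd n then Nat.totient n else 2 * Nat.totient (n / 2)) := by
  simp only [ramanujanSum_pm_one_iff_gcd hn]
  refine ⟨⟨fun ⟨m, _, h⟩ => h.1, fun hs => ?_⟩, fun hs => ?_⟩
  · refine ⟨1 % n, Finset.mem_range.2 (Nat.mod_lt _ hn), hs, .inl ?_⟩
    rw [Nat.gcd_comm, ← Nat.gcd_rec, Nat.gcd_one_right]
  · simp only [hs, true_and]
    split_ifs with hodd
    · rw [← Nat.div_one n, Nat.totient_div_of_dvd (one_dvd n), Nat.div_one]
      congr 1
      refine Finset.filter_congr fun m _ => or_iff_left fun h => ?_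
      exact hodd.not_two_dvd_nat (h ▸ Nat.gcd_dvd_left n m)
    · rw [Nat.not_odd_iff_even] at hodd
      obtain ⟨a, rfl⟩ := hodd.two_dvd
      have ha : Odd a := Nat.coprime_two_left.1 (Nat.coprime_of_squarefree_mul hs)
      have h1 := Nat.totient_div_of_dvd (one_dvd (2 * a))
      have h2 := Nat.totient_div_of_dvd (Dvd.intro a rfl : 2 ∣ 2 * a)
      rw [Nat.div_one, Nat.totient_two_mul_of_odd ha] at h1
      rw [Nat.mul_div_cancel_left a two_pos] at h2 ⊢
      rw [Finset.filter_or, Finset.card_union_of_disjoint, two_mul (Nat.totient a)]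
      · rw [← h1, ← h2]
      · exact Finset.disjoint_filter.2 fun m _ h h' => by omega
end

section
/- Let n ≥ 2 be an integer. The unitary Cayley graph X_n is distance regular if and only if n is a prime power or n = 2p for some odd prime p. -/
/-- A finite connected simple graph is distance regular if the number of vertices `w` at
distance `i` from `u` and distance `j` from `v` depends only on `i`, `j` and the distance
between `u` and `v`. -/
def IsDistanceRegular {V : Type*} [Fintype V] (G : SimpleGraph V) : Prop :=
  G.Connected ∧ ∃ f : ℕ → ℕ → ℕ → ℕ, ∀ u v : V, ∀ i j : ℕ,
    Set.ncard {w : V | G.dist u w = i ∧ G.dist v w = j} = f i j (G.dist u v)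

/-- The unitary Cayley graph `X_n`: vertices are `ℤ/nℤ`, and distinct `x, y` are adjacent
iff `x − y` is a unit of `ℤ/nℤ`. -/
def unitaryCayley (n : ℕ) : SimpleGraph (ZMod n) :=
  SimpleGraph.fromRel (fun x y => IsUnit (x - y))

open SimpleGraph

/-! ### Sums of two units in a ring -/

/-- The units `u` for which `z - u` is also a unit. In a unitary Cayley graph these are the common
neighbours of `0` and `z`. -/
def unitSums {R : Type*} [CommRing R] (z : R) : Set R := {u | IsUnit u ∧ IsUnit (z - u)}

section UnitSums

variable {R S : Type*} [CommRing R] [CommRing S]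

lemma ncard_unitSums_map (e : R ≃+* S) (z : R) :
    (unitSums (e z)).ncard = (unitSums z).ncard := by
  rw [← Set.ncard_image_of_injective _ e.injective]
  congr 1
  ext w
  obtain ⟨u, rfl⟩ := e.surjective w
  simp [unitSums, ← map_sub]

lemma unitSums_prod (x : R) (y : S) : unitSums (x, y) = unitSums x ×ˢ unitSums y := by
  ext ⟨u, v⟩
  simp only [unitSums, Set.mem_ofPred_eq, Set.mem_prod, Prod.isUnit_iff, Prod.mk_sub_mk]
  tauto

lemma ncard_unitSums_prod (x : R) (y : S) :
    (unitSums (x, y)).ncard = (unitSums x).ncard * (unitSums y).ncard := by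
  rw [unitSums_prod, Set.ncard_prod]

lemma unitSums_zero : unitSums (0 : R) = {u | IsUnit u} := by
  ext u
  simp [unitSums]

lemma unitSums_of_not_isUnit [IsLocalRing R] {z : R} (hz : ¬ IsUnit z) :
    unitSums z = {u | IsUnit u} := by
  ext u
  refine ⟨fun h ↦ h.1, fun h ↦ ⟨h, ?_⟩⟩
  by_contra h'
  refine IsLocalRing.nonunits_add (a := z) (b := u - z) hz ?_ (by simpa using h)
  rwa [mem_nonunits_iff, ← neg_sub, IsUnit.neg_iff]

end UnitSums

lemma isLocalRing_zmod_prime_pow {p : ℕ} (hp : p.Prime) (k : ℕ) :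
    IsLocalRing (ZMod (p ^ (k + 1))) := by
  have : NeZero (p ^ (k + 1)) := ⟨pow_ne_zero _ hp.ne_zero⟩
  have : Fact (1 < p ^ (k + 1)) := ⟨Nat.one_lt_pow k.succ_ne_zero hp.one_lt⟩
  have key (a : ℕ) : (a : ZMod (p ^ (k + 1))) ∈ nonunits _ ↔ p ∣ a := by
    rw [mem_nonunits_iff, ZMod.isUnit_iff_coprime, Nat.coprime_pow_right_iff k.succ_pos,
      Nat.coprime_comm, hp.coprime_iff_not_dvd, not_not]
  refine IsLocalRing.of_nonunits_add fun a b ha hb ↦ ?_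
  rw [← ZMod.natCast_zmod_val a] at ha ⊢
  rw [← ZMod.natCast_zmod_val b] at hb ⊢
  rw [← Nat.cast_add, key]
  exact dvd_add ((key _).1 ha) ((key _).1 hb)

lemma ncard_isUnit_zmod (n : ℕ) [NeZero n] : {u : ZMod n | IsUnit u}.ncard = n.totient := by
  rw [← ZMod.card_units_eq_totient, ← Nat.card_eq_fintype_card, ← Nat.card_coe_set_eq]
  exact Nat.card_congr
    ⟨fun u ↦ u.2.unit, fun u ↦ ⟨u, u.isUnit⟩, fun _ ↦ rfl, fun _ ↦ Units.ext rfl⟩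

lemma ncard_unitSums_zmod_of_not_isUnit {p : ℕ} (hp : p.Prime) (k : ℕ)
    {z : ZMod (p ^ (k + 1))} (hz : ¬ IsUnit z) :
    (unitSums z).ncard = p ^ k * (p - 1) := by
  have : NeZero (p ^ (k + 1)) := ⟨pow_ne_zero _ hp.ne_zero⟩
  have := isLocalRing_zmod_prime_pow hp k
  rw [unitSums_of_not_isUnit hz, ncard_isUnit_zmod, Nat.totient_prime_pow_succ hp]

lemma ncard_unitSums_zmod_one {p : ℕ} (hp : p.Prime) (k : ℕ) :
    (unitSums (1 : ZMod (p ^ (k + 1)))).ncard = p ^ k * (p - 2) := by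
  have : NeZero (p ^ (k + 1)) := ⟨pow_ne_zero _ hp.ne_zero⟩
  have := isLocalRing_zmod_prime_pow hp k
  have hU := ncard_isUnit_zmod (p ^ (k + 1))
  rw [Nat.totient_prime_pow_succ hp] at hU
  have hN := Set.ncard_add_ncard_compl {u : ZMod (p ^ (k + 1)) | IsUnit u}
  rw [hU, Nat.card_zmod] at hN
  set N := {u : ZMod (p ^ (k + 1)) | IsUnit u}ᶜ with hNdef
  have himg : ((fun u ↦ 1 - u) '' N).ncard = N.ncard :=
    Set.ncard_image_of_injective _ (sub_right_injective)
  have hdisj : Disjoint N ((fun u ↦ 1 - u) '' N) := by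
    rw [Set.disjoint_left]
    rintro _ hu ⟨v, hv, rfl⟩
    exact IsLocalRing.nonunits_add hu hv (by simp)
  have hunion : unitSums (1 : ZMod (p ^ (k + 1))) = (N ∪ (fun u ↦ 1 - u) '' N)ᶜ := by
    ext u
    have : u ∈ (fun u ↦ 1 - u) '' N ↔ ¬ IsUnit (1 - u) :=
      ⟨by rintro ⟨v, hv, rfl⟩; simpa [hNdef] using hv, fun h ↦ ⟨1 - u, h, by simp⟩⟩
    simp only [Set.mem_compl_iff, Set.mem_union, hNdef, unitSums, Set.mem_ofPred_eq]
    tauto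
  have htot := Set.ncard_add_ncard_compl (N ∪ (fun u ↦ 1 - u) '' N)
  rw [← hunion, Set.ncard_union_eq hdisj, himg, Nat.card_zmod] at htot
  obtain ⟨r, rfl⟩ := Nat.exists_eq_add_of_le hp.two_le
  have h1 : 2 + r - 1 = r + 1 := by omega
  rw [h1] at hN
  rw [Nat.add_sub_cancel_left]
  have h2 : (2 + r) ^ (k + 1) = (2 + r) ^ k * (2 + r) := pow_succ _ _
  linarith

/-! ### Basic properties of unitary Cayley graphs -/

section UnitaryCayley

variable {n : ℕ} [Fact (1 < n)]

lemma unitaryCayley_adj {x y : ZMod n} : (unitaryCayley n).Adj x y ↔ IsUnit (x - y) := by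
  rw [unitaryCayley, fromRel_adj, ← neg_sub x y, IsUnit.neg_iff, or_self, and_iff_right_iff_imp]
  rintro h rfl
  simp at h

lemma unitaryCayley_zero_adj {x : ZMod n} : (unitaryCayley n).Adj 0 x ↔ IsUnit x := by
  rw [unitaryCayley_adj, zero_sub, IsUnit.neg_iff]

lemma unitaryCayley_connected : (unitaryCayley n).Connected := by
  have : NeZero n := ⟨(zero_lt_one.trans Fact.out).ne'⟩
  have key (k : ℕ) : (unitaryCayley n).Reachable 0 (k : ZMod n) := by
    induction k with
    | zero => simp
    | succ k ih =>
      refine ih.trans (Adj.reachable ?_)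
      rw [unitaryCayley_adj]
      simp
  rw [connected_iff_exists_forall_reachable]
  exact ⟨0, fun x ↦ by simpa using key x.val⟩

lemma unitaryCayley_dist_eq_two {z : ZMod n} (h0 : z ≠ 0) (hz : ¬ IsUnit z)
    (h : (unitSums z).Nonempty) : (unitaryCayley n).dist 0 z = 2 := by
  obtain ⟨u, hu, hu'⟩ := h
  have h1 : (unitaryCayley n).dist 0 u = 1 :=
    dist_eq_one_iff_adj.2 (unitaryCayley_zero_adj.2 hu)
  have h2 : (unitaryCayley n).dist u z = 1 :=
    dist_eq_one_iff_adj.2 (unitaryCayley_adj.2 hu').symm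
  have h3 := unitaryCayley_connected.dist_triangle (G := unitaryCayley n) (u := 0) (v := u) (w := z)
  have h4 := unitaryCayley_connected.pos_dist_of_ne (G := unitaryCayley n) h0.symm
  have h5 : (unitaryCayley n).dist 0 z ≠ 1 := by
    rwa [Ne, dist_eq_one_iff_adj, unitaryCayley_zero_adj]
  omega

lemma unitSums_nonempty_of_dist_eq_two {z : ZMod n} (h : (unitaryCayley n).dist 0 z = 2) :
    (unitSums z).Nonempty := by
  obtain ⟨w, hw⟩ := unitaryCayley_connected.exists_walk_length_eq_dist (G := unitaryCayley n) 0 z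
  rw [h] at hw
  match w, hw with
  | .cons h₁ (.cons h₂ .nil), _ =>
    exact ⟨_, unitaryCayley_zero_adj.1 h₁, unitaryCayley_adj.1 h₂.symm⟩

/-- In a distance regular unitary Cayley graph, the number of common neighbours of two vertices at
distance two is constant. -/
lemma IsDistanceRegular.ncard_unitSums_eq [NeZero n] {S : Type*} [CommRing S]
    (h : IsDistanceRegular (unitaryCayley n)) (e : ZMod n ≃+* S) {x y : S}
    (hx0 : x ≠ 0) (hx : ¬ IsUnit x) (hx' : (unitSums x).ncard ≠ 0)
    (hy0 : y ≠ 0) (hy : ¬ IsUnit y) (hy' : (unitSums y).ncard ≠ 0) :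
    (unitSums x).ncard = (unitSums y).ncard := by
  obtain ⟨x, rfl⟩ := e.surjective x
  obtain ⟨y, rfl⟩ := e.surjective y
  simp only [ncard_unitSums_map, ne_eq, map_eq_zero_iff e e.injective, MulEquiv.isUnit_map] at *
  obtain ⟨-, f, hf⟩ := h
  have key (z : ZMod n) (h0 : z ≠ 0) (hz : ¬ IsUnit z) (hz' : (unitSums z).ncard ≠ 0) :
      (unitSums z).ncard = f 1 1 2 := by
    rw [← unitaryCayley_dist_eq_two h0 hz (Set.nonempty_of_ncard_ne_zero hz'), ← hf 0 z 1 1]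
    simp only [dist_eq_one_iff_adj, unitaryCayley_adj, zero_sub, IsUnit.neg_iff, unitSums]
  rw [key x hx0 hx hx', key y hy0 hy hy']

end UnitaryCayley

/-! ### Distance transitive graphs are distance regular -/

lemma SimpleGraph.Iso.dist_map {V W : Type*} {G : SimpleGraph V} {H : SimpleGraph W} (φ : G ≃g H)
    (u v : V) : H.dist (φ u) (φ v) = G.dist u v := by
  by_cases h : G.Reachable u v
  · refine le_antisymm ?_ ?_
    · obtain ⟨w, hw⟩ := h.exists_walk_length_eq_dist
      rw [← hw, ← Walk.length_map φ.toHom]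
      exact dist_le _
    · obtain ⟨w, hw⟩ := (Iso.reachable_iff (φ := φ).2 h).exists_walk_length_eq_dist
      rw [← hw, ← Walk.length_map φ.symm.toHom]
      have := dist_le (w.map φ.symm.toHom)
      simpa using this
  · rw [dist_eq_zero_of_not_reachable h,
      dist_eq_zero_of_not_reachable (mt (Iso.reachable_iff (φ := φ)).1 h)]

lemma isDistanceRegular_of_transitive {V : Type*} [Fintype V] {G : SimpleGraph V}
    (hG : G.Connected)
    (h : ∀ u v u' v', G.dist u v = G.dist u' v' → ∃ φ : G ≃g G, φ u = u' ∧ φ v = v') :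
    IsDistanceRegular G := by
  classical
  refine ⟨hG, fun i j d ↦ if hd : ∃ q : V × V, G.dist q.1 q.2 = d then
    {w | G.dist hd.choose.1 w = i ∧ G.dist hd.choose.2 w = j}.ncard else 0, fun u v i j ↦ ?_⟩
  have hd : ∃ q : V × V, G.dist q.1 q.2 = G.dist u v := ⟨(u, v), rfl⟩
  simp only [dif_pos hd]
  obtain ⟨φ, h₁, h₂⟩ := h _ _ _ _ hd.choose_spec.symm
  rw [← h₁, ← h₂, ← Set.ncard_image_of_injective _ φ.injective]
  congr 1
  ext w
  obtain ⟨x, rfl⟩ := φ.surjective w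
  simp [φ.dist_map]

/-- Multiplication by a unit is an automorphism of a unitary Cayley graph. -/
lemma exists_iso_of_unit_mul {n : ℕ} [Fact (1 < n)] {x y : ZMod n} (a : (ZMod n)ˣ)
    (h : a * x = y) : ∃ φ : unitaryCayley n ≃g unitaryCayley n, φ 0 = 0 ∧ φ x = y :=
  ⟨⟨a.mulLeft, by simp [unitaryCayley_adj, ← mul_sub]⟩, mul_zero _, h⟩

/-- Translations act transitively on a unitary Cayley graph, so distance transitivity only has to
be checked for the stabilizer of `0`. -/
lemma unitaryCayley_isDistanceRegular_of_transitive {n : ℕ} [NeZero n] [Fact (1 < n)]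
    (h : ∀ x y : ZMod n, x ≠ 0 → y ≠ 0 → ¬ IsUnit x → ¬ IsUnit y →
      (unitaryCayley n).dist 0 x = (unitaryCayley n).dist 0 y →
      ∃ φ : unitaryCayley n ≃g unitaryCayley n, φ 0 = 0 ∧ φ x = y) :
    IsDistanceRegular (unitaryCayley n) := by
  let τ (a : ZMod n) : unitaryCayley n ≃g unitaryCayley n :=
    ⟨Equiv.addRight a, by simp [unitaryCayley_adj]⟩
  have hτ (a x : ZMod n) : τ a x = x + a := rfl
  have hconn := unitaryCayley_connected (n := n)
  have key (x y : ZMod n) (hxy : (unitaryCayley n).dist 0 x = (unitaryCayley n).dist 0 y) :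
      ∃ φ : unitaryCayley n ≃g unitaryCayley n, φ 0 = 0 ∧ φ x = y := by
    have hzero : x = 0 ↔ y = 0 := by
      rw [eq_comm, ← hconn.dist_eq_zero_iff, hxy, hconn.dist_eq_zero_iff, eq_comm]
    have hunit : IsUnit x ↔ IsUnit y := by
      rw [← unitaryCayley_zero_adj, ← dist_eq_one_iff_adj, hxy, dist_eq_one_iff_adj,
        unitaryCayley_zero_adj]
    by_cases hx0 : x = 0
    · exact ⟨.refl, rfl, hx0.trans (hzero.1 hx0).symm⟩
    by_cases hx : IsUnit x
    · obtain ⟨a, rfl⟩ := hx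
      obtain ⟨b, rfl⟩ := hunit.1 a.isUnit
      exact exists_iso_of_unit_mul (b * a⁻¹) (by simp)
    · exact h x y hx0 (mt hzero.2 hx0) hx (mt hunit.2 hx) hxy
  refine isDistanceRegular_of_transitive hconn fun u v u' v' huv ↦ ?_
  have hsub (u v : ZMod n) : (unitaryCayley n).dist 0 (v - u) = (unitaryCayley n).dist u v := by
    simpa [hτ] using ((τ u).dist_map 0 (v - u)).symm
  rw [← hsub u v, ← hsub u' v'] at huv
  obtain ⟨φ, h0, h1⟩ := key _ _ huv
  exact ⟨((τ (-u)).trans φ).trans (τ u'), by simp [hτ, h0], by simp [hτ, ← sub_eq_add_neg, h1]⟩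

lemma unitaryCayley_prime_pow_isDistanceRegular {p : ℕ} (hp : p.Prime) (k : ℕ)
    [NeZero (p ^ (k + 1))] : IsDistanceRegular (unitaryCayley (p ^ (k + 1))) := by
  have : Fact (1 < p ^ (k + 1)) := ⟨Nat.one_lt_pow k.succ_ne_zero hp.one_lt⟩
  have := isLocalRing_zmod_prime_pow hp k
  refine unitaryCayley_isDistanceRegular_of_transitive fun x y hx0 hy0 hx hy _ ↦ ?_
  have hsub {a b : ZMod (p ^ (k + 1))} (ha : ¬ IsUnit a) : IsUnit (a - b) ↔ IsUnit b := by
    refine ⟨fun h ↦ ?_, fun h ↦ (unitSums_of_not_isUnit ha ▸ h : b ∈ unitSums a).2⟩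
    simpa using (unitSums_of_not_isUnit ha ▸ h : a - b ∈ unitSums a).2
  have hsub' {a b : ZMod (p ^ (k + 1))} (hb : ¬ IsUnit b) : IsUnit (a - b) ↔ IsUnit a := by
    rw [← neg_sub, IsUnit.neg_iff, hsub hb]
  have hswap (a : ZMod (p ^ (k + 1))) :
      Equiv.swap x y a = a ∨ ¬ IsUnit a ∧ ¬ IsUnit (Equiv.swap x y a) := by
    rcases eq_or_ne a x with rfl | hax
    · simp [hx, hy]
    rcases eq_or_ne a y with rfl | hay
    · simp [hx, hy]
    · exact .inl (Equiv.swap_apply_of_ne_of_ne hax hay)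
  refine ⟨⟨Equiv.swap x y, fun {a b} ↦ ?_⟩, Equiv.swap_apply_of_ne_of_ne hx0.symm hy0.symm,
    Equiv.swap_apply_left x y⟩
  rw [unitaryCayley_adj, unitaryCayley_adj]
  rcases hswap a with ha | ⟨ha, ha'⟩ <;> rcases hswap b with hb | ⟨hb, hb'⟩
  · rw [ha, hb]
  · rw [ha, hsub' hb', hsub' hb]
  · rw [hb, hsub ha', hsub ha]
  · rw [hsub ha', hsub ha, iff_false_intro hb, iff_false_intro hb']

/-- Nonzero nonunits of `ℤ/2ℤ × ℤ/pℤ` are associated as soon as both or neither of them is a sum of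
two units. -/
lemma exists_unit_mul_eq_of_unitSums {p : ℕ} (hp : p.Prime) (hodd : Odd p) {x y : ZMod 2 × ZMod p}
    (hx0 : x ≠ 0) (hy0 : y ≠ 0) (hx : ¬ IsUnit x) (hy : ¬ IsUnit y)
    (h : (unitSums x).Nonempty ↔ (unitSums y).Nonempty) :
    ∃ a : (ZMod 2 × ZMod p)ˣ, a * x = y := by
  have : Fact p.Prime := ⟨hp⟩
  have h2 : (2 : ZMod p) ≠ 0 := by
    refine Ring.two_ne_zero ?_
    rw [ZMod.ringChar_zmod_n]
    rintro rfl
    exact absurd hodd (by decide)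
  have hfst (a : ZMod 2) : a = 0 ∨ a = 1 := by
    revert a; decide
  have key (b : ZMod p) (hb : b ≠ 0) : (unitSums ((0, b) : ZMod 2 × ZMod p)).Nonempty := by
    refine ⟨(1, -b), ?_, ?_⟩
    · simp [Prod.isUnit_iff, hb]
    · simp [Prod.isUnit_iff, ← two_mul, h2, hb]
  have key' (b : ZMod p) : ¬ (unitSums ((1, b) : ZMod 2 × ZMod p)).Nonempty := by
    rintro ⟨⟨u, v⟩, hu, hu'⟩
    simp only [Prod.isUnit_iff, Prod.mk_sub_mk, isUnit_iff_ne_zero] at hu hu'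
    rcases hfst u with rfl | rfl <;> simp at hu hu'
  obtain ⟨a, b⟩ := x
  obtain ⟨c, d⟩ := y
  rcases hfst a with rfl | rfl <;> rcases hfst c with rfl | rfl
  · have hb : b ≠ 0 := by rintro rfl; exact hx0 rfl
    have hd : d ≠ 0 := by rintro rfl; exact hy0 rfl
    obtain ⟨a, ha⟩ : IsUnit ((1, d / b) : ZMod 2 × ZMod p) := by simp [Prod.isUnit_iff, hb, hd]
    exact ⟨a, by simp [ha, hb]⟩
  · have hb : b ≠ 0 := by rintro rfl; exact hx0 rfl
    exact absurd (h.1 (key b hb)) (key' d)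
  · have hd : d ≠ 0 := by rintro rfl; exact hy0 rfl
    exact absurd (h.2 (key d hd)) (key' b)
  · have hb : b = 0 := by simpa [Prod.isUnit_iff] using hx
    have hd : d = 0 := by simpa [Prod.isUnit_iff] using hy
    exact ⟨1, by simp [hb, hd]⟩

lemma unitaryCayley_two_mul_isDistanceRegular {p : ℕ} (hp : p.Prime) (hodd : Odd p)
    [NeZero (2 * p)] : IsDistanceRegular (unitaryCayley (2 * p)) := by
  have : Fact (1 < 2 * p) := ⟨by have := hp.pos; omega⟩
  let e := ZMod.chineseRemainder (Nat.coprime_two_left.2 hodd)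
  have := Fact.mk hp
  refine unitaryCayley_isDistanceRegular_of_transitive fun x y hx0 hy0 hx hy hxy ↦ ?_
  have hsum (z : ZMod (2 * p)) : (unitSums (e z)).Nonempty ↔ (unitSums z).Nonempty := by
    rw [← Set.ncard_pos, ← Set.ncard_pos, ncard_unitSums_map]
  have h : (unitSums x).Nonempty ↔ (unitSums y).Nonempty :=
    ⟨fun h ↦ unitSums_nonempty_of_dist_eq_two (hxy ▸ unitaryCayley_dist_eq_two hx0 hx h),
      fun h ↦ unitSums_nonempty_of_dist_eq_two (hxy ▸ unitaryCayley_dist_eq_two hy0 hy h)⟩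
  obtain ⟨a, ha⟩ := exists_unit_mul_eq_of_unitSums hp hodd (x := e x) (y := e y) (by simpa)
    (by simpa) (by simpa) (by simpa) (by rwa [hsum, hsum])
  refine exists_iso_of_unit_mul (Units.map e.symm.toRingHom.toMonoidHom a) (e.injective ?_)
  simp [← ha]

/-! ### Unitary Cayley graphs that are not distance regular -/

lemma not_isDistanceRegular_of_two_odd_primes {n p q : ℕ} [NeZero n] (hp : p.Prime)
    (hq : q.Prime) (hpq : p ≠ q) (hp2 : p ≠ 2) (hq2 : q ≠ 2) (hpn : p ∣ n) (hqn : q ∣ n) :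
    ¬ IsDistanceRegular (unitaryCayley n) := by
  intro h
  obtain ⟨a, m', hpm', hm'⟩ := Nat.exists_eq_pow_mul_and_not_dvd (NeZero.ne n) p hp.ne_one
  have hm0 : m' ≠ 0 := by rintro rfl; simp at hpm'
  obtain ⟨b, m, hqm, hm⟩ := Nat.exists_eq_pow_mul_and_not_dvd hm0 q hq.ne_one
  have hqm' : q ∣ m' := (((Nat.coprime_primes hq hp).2 hpq.symm).pow_right a).dvd_of_dvd_mul_left
    (hm' ▸ hqn)
  obtain _ | a := a
  · simp [hm'] at hpn; contradiction
  obtain _ | b := b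
  · simp [hm] at hqm'; contradiction
  have hmz : NeZero m := ⟨by rintro rfl; simp at hqm⟩
  have : Fact (1 < n) := ⟨hp.one_lt.trans_le (Nat.le_of_dvd (NeZero.pos n) hpn)⟩
  have : Fact (1 < p ^ (a + 1)) := ⟨Nat.one_lt_pow a.succ_ne_zero hp.one_lt⟩
  have : Fact (1 < q ^ (b + 1)) := ⟨Nat.one_lt_pow b.succ_ne_zero hq.one_lt⟩
  have c₁ : (p ^ (a + 1)).Coprime m' := ((hp.coprime_iff_not_dvd).2 hpm').pow_left _
  have c₂ : (q ^ (b + 1)).Coprime m := ((hq.coprime_iff_not_dvd).2 hqm).pow_left _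
  let e : ZMod n ≃+* ZMod (p ^ (a + 1)) × ZMod (q ^ (b + 1)) × ZMod m :=
    ((ZMod.ringEquivCongr hm').trans (ZMod.chineseRemainder c₁)).trans
      ((RingEquiv.refl _).prodCongr ((ZMod.ringEquivCongr hm).trans (ZMod.chineseRemainder c₂)))
  have hp3 : 3 ≤ p := by have := hp.two_le; omega
  have hq3 : 3 ≤ q := by have := hq.two_le; omega
  have hm1 : (unitSums (0 : ZMod m)).ncard ≠ 0 := by
    rw [unitSums_zero, ncard_isUnit_zmod]
    exact (Nat.totient_pos.2 (NeZero.pos m)).ne'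
  have hpa : p ^ a ≠ 0 := pow_ne_zero _ hp.ne_zero
  have hqb : q ^ b ≠ 0 := pow_ne_zero _ hq.ne_zero
  have key := h.ncard_unitSums_eq e (x := (1, 0, 0)) (y := (0, 1, 0))
    (by simp) (by simp [Prod.isUnit_iff]) ?_ (by simp) (by simp [Prod.isUnit_iff]) ?_
  all_goals
    simp only [ncard_unitSums_prod, ncard_unitSums_zmod_one hp, ncard_unitSums_zmod_one hq,
      ncard_unitSums_zmod_of_not_isUnit hp a not_isUnit_zero,
      ncard_unitSums_zmod_of_not_isUnit hq b not_isUnit_zero] at *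
  · have h1 : p ^ a * q ^ b * (unitSums (0 : ZMod m)).ncard ≠ 0 := by positivity
    have h2 : (p - 2) * (q - 1) = (p - 1) * (q - 2) := by
      apply mul_left_cancel₀ h1
      linarith
    obtain ⟨r, rfl⟩ := Nat.exists_eq_add_of_le hp.two_le
    obtain ⟨s, rfl⟩ := Nat.exists_eq_add_of_le hq.two_le
    rw [show 2 + r - 2 = r by omega, show 2 + r - 1 = r + 1 by omega,
      show 2 + s - 2 = s by omega, show 2 + s - 1 = s + 1 by omega] at h2
    apply hpq
    linarith
  · have : p - 2 ≠ 0 := by omega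
    have : q - 1 ≠ 0 := by omega
    positivity
  · have : p - 1 ≠ 0 := by omega
    have : q - 2 ≠ 0 := by omega
    positivity

lemma not_isDistanceRegular_two_pow_mul_prime_pow {q : ℕ} (hq : q.Prime) (hq2 : q ≠ 2) (a b : ℕ)
    (hab : a ≠ 0 ∨ b ≠ 0) [NeZero (2 ^ (a + 1) * q ^ (b + 1))] :
    ¬ IsDistanceRegular (unitaryCayley (2 ^ (a + 1) * q ^ (b + 1))) := by
  intro h
  have f₁ : 1 < 2 ^ (a + 1) := Nat.one_lt_pow a.succ_ne_zero one_lt_two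
  have f₂ : 1 < q ^ (b + 1) := Nat.one_lt_pow b.succ_ne_zero hq.one_lt
  have : Fact (1 < 2 ^ (a + 1) * q ^ (b + 1)) := ⟨Nat.one_lt_mul_iff.2 ⟨by omega, by omega, .inl f₁⟩⟩
  have := Fact.mk f₁
  have := Fact.mk f₂
  let e := ZMod.chineseRemainder
    (((Nat.coprime_primes Nat.prime_two hq).2 hq2.symm).pow (a + 1) (b + 1))
  have hq3 : 3 ≤ q := by have := hq.two_le; omega
  have hqb : q ^ b ≠ 0 := pow_ne_zero _ hq.ne_zero
  obtain ⟨x, y, hx, hy, hxy⟩ : ∃ (x : ZMod (2 ^ (a + 1))) (y : ZMod (q ^ (b + 1))),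
      ¬ IsUnit x ∧ ¬ IsUnit y ∧ (x, y) ≠ 0 := by
    have hne {p k : ℕ} (hp : p.Prime) (hk : k ≠ 0) : (p : ZMod (p ^ (k + 1))) ≠ 0 := by
      rw [Ne, ZMod.natCast_eq_zero_iff]
      intro hdvd
      have := (Nat.pow_dvd_pow_iff_le_right (l := 1) hp.one_lt).1 (by simpa using hdvd)
      omega
    rcases hab with ha | hb
    · exact ⟨(2 : ℕ), 0, ZMod.prime_natCast_not_isUnit_pow Nat.prime_two a.succ_pos,
        not_isUnit_zero, fun h ↦ hne Nat.prime_two ha (congrArg Prod.fst h)⟩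
    · exact ⟨0, (q : ℕ), not_isUnit_zero, ZMod.prime_natCast_not_isUnit_pow hq b.succ_pos,
        fun h ↦ hne hq hb (congrArg Prod.snd h)⟩
  have hq1 : q - 1 ≠ 0 := by omega
  have hq2' : q - 2 ≠ 0 := by omega
  have key := h.ncard_unitSums_eq e (x := (0, 1)) (y := (x, y))
    (by simp) (by simp [Prod.isUnit_iff]) ?_ hxy (by simp [Prod.isUnit_iff, hx]) ?_
  all_goals
    simp only [ncard_unitSums_prod, ncard_unitSums_zmod_one hq,
      ncard_unitSums_zmod_of_not_isUnit hq b hy,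
      ncard_unitSums_zmod_of_not_isUnit Nat.prime_two a hx,
      ncard_unitSums_zmod_of_not_isUnit Nat.prime_two a not_isUnit_zero] at *
  · have := mul_left_cancel₀ hqb (mul_left_cancel₀ (by positivity) key)
    omega
  · positivity
  · positivity

/-- `X_n` is distance regular iff `n` is a prime power or `n = 2p` for an odd prime `p`. -/
theorem ucg_distance_regular_iff (n : ℕ) [NeZero n] (hn : 2 ≤ n) :
    IsDistanceRegular (unitaryCayley n) ↔
      IsPrimePow n ∨ ∃ p : ℕ, p.Prime ∧ Odd p ∧ n = 2 * p := by
  constructor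
  · intro h
    have hodd {p q : ℕ} (hp : p.Prime) (hq : q.Prime) (hp2 : p ≠ 2) (hq2 : q ≠ 2) (hpn : p ∣ n)
        (hqn : q ∣ n) : p = q := by
      by_contra hpq
      exact not_isDistanceRegular_of_two_odd_primes hp hq hpq hp2 hq2 hpn hqn h
    obtain ⟨a, m, h2m, rfl⟩ := Nat.exists_eq_pow_mul_and_not_dvd (NeZero.ne n) 2 (by simp)
    by_cases hm1 : m = 1
    · subst hm1
      refine .inl ?_
      rw [mul_one, isPrimePow_nat_iff]
      refine ⟨2, a, Nat.prime_two, Nat.pos_of_ne_zero ?_, rfl⟩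
      rintro rfl
      simp at hn
    have hm : IsPrimePow m := by
      refine isPrimePow_iff_unique_prime_dvd.2 ⟨m.minFac, ⟨Nat.minFac_prime hm1, m.minFac_dvd⟩, ?_⟩
      rintro q ⟨hq, hqm⟩
      refine hodd hq (Nat.minFac_prime hm1) ?_ ?_ (hqm.mul_left _) (m.minFac_dvd.mul_left _)
      · rintro rfl; exact h2m hqm
      · intro h2; exact h2m (h2 ▸ m.minFac_dvd)
    obtain _ | a := a
    · simpa using .inl hm
    rw [isPrimePow_nat_iff] at hm
    obtain ⟨q, b, hq, hb, rfl⟩ := hm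
    obtain ⟨b, rfl⟩ := Nat.exists_eq_succ_of_ne_zero hb.ne'
    have hq2 : q ≠ 2 := by rintro rfl; exact h2m (dvd_pow_self _ b.succ_ne_zero)
    by_cases hab : a ≠ 0 ∨ b ≠ 0
    · exact absurd h (not_isDistanceRegular_two_pow_mul_prime_pow hq hq2 a b hab)
    · push Not at hab
      obtain ⟨rfl, rfl⟩ := hab
      exact .inr ⟨q, hq, hq.odd_of_ne_two hq2, by simp⟩
  · rintro (h | ⟨p, hp, hodd, rfl⟩)
    · rw [isPrimePow_nat_iff] at h
      obtain ⟨p, k, hp, hk, rfl⟩ := h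
      obtain ⟨k, rfl⟩ := Nat.exists_eq_succ_of_ne_zero hk.ne'
      exact unitaryCayley_prime_pow_isDistanceRegular hp k
    · exact unitaryCayley_two_mul_isDistanceRegular hp hodd
end
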